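/- Reconstruction: Let (A,T) be an abstract space with β̲ := min A ∈ (−4,0) and let Γ be a skeleton on (A,T). Assume v ∈ S'(ℝ²;T) satisfies ‖Γ_β(x)v_T(x)‖_{T_β} ≤ (T^{1/4})^β for all β ∈ A, all x ∈ ℝ², and all 0 < T ≤ 1. Then for every modelled distribution V ∈ D^ᾱ(T;Γ) with ᾱ > 0 there exists a unique tempered distribution RV ∈ S'(ℝ²) such that for all 0 < T ≤ 1 one has ‖(RV)_T − V.v_T‖ ≤ C (1+‖Γ‖_sk)^{|A|−1} [V]_{D^ᾱ(T;Γ)} (T^{1/4})^{ᾱ}, where V.v_T denotes the function x ↦ V(x).(v_T(x)) and C depends only on A and ᾱ. -/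

import Mathlib

open scoped BigOperators
open MeasureTheory

noncomputable section

/-- The parabolic metric `d(x,y) = |x₁−y₁| + √|x₂−y₂|` on `ℝ²`. -/
def pdist (x y : ℝ × ℝ) : ℝ := |x.1 - y.1| + Real.sqrt |x.2 - y.2|

/-- The kernel `ψ_T`, the inverse Fourier transform of `exp(−T(k₁⁴+k₂²))`. -/
def psiK (T : ℝ) (x : ℝ × ℝ) : ℝ :=
  ∫ k : ℝ × ℝ, Real.exp (-(T * (k.1 ^ 4 + k.2 ^ 2))) *
    Real.cos (2 * Real.pi * (k.1 * x.1 + k.2 * x.2))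

/-- Mollification at scale `t` by convolution with `ψ_t`. -/
def mollify {E : Type*} [NormedAddCommGroup E] [NormedSpace ℝ E]
    (t : ℝ) (g : ℝ × ℝ → E) (x : ℝ × ℝ) : E :=
  ∫ y : ℝ × ℝ, psiK t (x - y) • g y

/-- A (vector valued) tempered distribution represented through its semigroup
mollifications `g_T`, with the semigroup property `(g_T)_t = g_{T+t}`. -/
structure MollDistrib (E : Type*) [NormedAddCommGroup E] [NormedSpace ℝ E] where
  app : ℝ → ℝ × ℝ → E
  cont : ∀ T : ℝ, 0 < T → Continuous (app T)
  semigroup : ∀ T : ℝ, 0 < T → ∀ t : ℝ, 0 < t → app (T + t) = mollify t (app T)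

/-- The data of a skeleton on the abstract space `(A, T = ⊕_{β∈A} T_β)`:
a triangular, strongly continuous family of operators. -/
structure PreSkeleton (A : Finset ℝ) (Tb : A → Type*)
    [∀ β, NormedAddCommGroup (Tb β)] [∀ β, NormedSpace ℝ (Tb β)] where
  mat : ℝ × ℝ → ∀ β γ : A, Tb γ →L[ℝ] Tb β
  cont : ∀ (β γ : A) (v : Tb γ), Continuous fun x => mat x β γ v
  diag : ∀ (x : ℝ × ℝ) (β : A), mat x β β = ContinuousLinearMap.id ℝ (Tb β)
  upper : ∀ (x : ℝ × ℝ) (β γ : A), (β : ℝ) < (γ : ℝ) → mat x β γ = 0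

namespace PreSkeleton

variable {A : Finset ℝ} {Tb : A → Type*}
  [∀ β, NormedAddCommGroup (Tb β)] [∀ β, NormedSpace ℝ (Tb β)]

/-- `Γ_β(x)v = v_β + ∑_{γ<β} Γ_β^γ(x) v_γ`. -/
def apply (S : PreSkeleton A Tb) (x : ℝ × ℝ) (β : A) (v : ∀ γ : A, Tb γ) : Tb β :=
  ∑ γ : A, S.mat x β γ (v γ)

/-- The continuity property (ssss2) of a skeleton, with constant `C`. -/
def IsSkelBound (S : PreSkeleton A Tb) (C : ℝ) : Prop :=
  ∀ (β : A) (v : ∀ γ : A, Tb γ) (x y : ℝ × ℝ), pdist y x ≤ 1 →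
    ‖S.apply y β v - S.apply x β v‖ ≤
      C * ∑ γ : A, (if (γ : ℝ) < (β : ℝ)
        then pdist y x ^ ((β : ℝ) - (γ : ℝ)) * ‖S.apply x γ v‖ else 0)

/-- `Γ` is a skeleton: the continuity property holds for some `C ≥ 0`. -/
def IsSkeleton (S : PreSkeleton A Tb) : Prop := ∃ C, 0 ≤ C ∧ S.IsSkelBound C

/-- `‖Γ‖_sk`, the least admissible constant in the continuity property. -/
def skelNorm (S : PreSkeleton A Tb) : ℝ := sInf {C | 0 ≤ C ∧ S.IsSkelBound C}

/-- Form boundedness of `V : ℝ² → T*` with constants `(M_β^b)`. -/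
def FormBounded (S : PreSkeleton A Tb) (V : ℝ × ℝ → (∀ γ : A, Tb γ) → ℝ)
    (Mb : A → ℝ) : Prop :=
  ∀ x v, |V x v| ≤ ∑ β : A, Mb β * ‖S.apply x β v‖

/-- Form continuity of order `ord` with constant `Mc`. -/
def FormContinuous (S : PreSkeleton A Tb) (ord : ℝ)
    (V : ℝ × ℝ → (∀ γ : A, Tb γ) → ℝ) (Mc : ℝ) : Prop :=
  ∀ x y v, pdist y x ≤ 1 →
    |V y v - V x v| ≤
      Mc * ∑ β : A, pdist y x ^ max (ord - (β : ℝ)) 0 * ‖S.apply x β v‖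

/-- `V` is a modelled distribution of order `ord` relative to the skeleton `S`. -/
def IsModelled (S : PreSkeleton A Tb) (ord : ℝ)
    (V : ℝ × ℝ → (∀ γ : A, Tb γ) → ℝ) : Prop :=
  (∀ x, IsLinearMap ℝ (V x)) ∧ (∀ v, Continuous fun x => V x v) ∧
    (∃ Mb : A → ℝ, (∀ β, 0 ≤ Mb β) ∧ S.FormBounded V Mb) ∧
    (∃ Mc : ℝ, 0 ≤ Mc ∧ S.FormContinuous ord V Mc)

/-- The seminorm `[V]_{D^{ord}(T;Γ)}`: least form-continuity constant. -/
def ctyNorm (S : PreSkeleton A Tb) (ord : ℝ)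
    (V : ℝ × ℝ → (∀ γ : A, Tb γ) → ℝ) : ℝ :=
  sInf {Mc | 0 ≤ Mc ∧ S.FormContinuous ord V Mc}

/-- The norm `‖V‖_{T;Γ}`: least `M` such that the constants `M·N^{⟨β⟩}` are
admissible for form boundedness. -/
def bdNorm (S : PreSkeleton A Tb) (N : ℝ) (exps : A → ℝ)
    (V : ℝ × ℝ → (∀ γ : A, Tb γ) → ℝ) : ℝ :=
  sInf {M | 0 ≤ M ∧ S.FormBounded V fun β => M * N ^ exps β}

/-- One step `(id − Γ_b)` of the reduction procedure. -/
def cutStep (S : PreSkeleton A Tb) (x : ℝ × ℝ) (b : ℝ)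
    (v : ∀ γ : A, Tb γ) : ∀ γ : A, Tb γ :=
  fun γ => v γ - if (γ : ℝ) = b then S.apply x γ v else 0

/-- The reduction of a vector: all levels `≥ η` are cut, in increasing order. -/
def cutVec (S : PreSkeleton A Tb) (x : ℝ × ℝ) (η : ℝ)
    (v : ∀ γ : A, Tb γ) : ∀ γ : A, Tb γ :=
  ((A.filter fun b => η ≤ b).sort (· ≤ ·)).foldl (fun w b => S.cutStep x b w) v

/-- The reduction `C_η V` of a modelled distribution. -/
def cutForm (S : PreSkeleton A Tb) (η : ℝ)
    (V : ℝ × ℝ → (∀ γ : A, Tb γ) → ℝ) : ℝ × ℝ → (∀ γ : A, Tb γ) → ℝ :=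
  fun x v => V x (S.cutVec x η v)

end PreSkeleton

/-- `m(η) = min{⟨β⟩ : β ∈ A, β ≥ η}`. -/
def minExpFrom (A : Finset ℝ) (exps : A → ℝ) (η : ℝ) : ℝ :=
  sInf {r | ∃ β : A, η ≤ (β : ℝ) ∧ r = exps β}

/-! ### One-dimensional kernels -/

theorem pow_mul_exp_neg_bounded (j : ℕ) (hj : 1 ≤ j) {T : ℝ} (hT : 0 < T) (n : ℕ) :
    ∃ C : ℝ, ∀ x : ℝ, |x| ^ n * Real.exp (-(T * x ^ (2 * j))) ≤ C := by
  refine ⟨1 + n.factorial / T ^ n, fun x => ?_⟩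
  have hx : 0 ≤ x ^ (2 * j) := by rw [pow_mul]; positivity
  have h1 : |x| ^ n ≤ 1 + (x ^ (2 * j)) ^ n := by
    rcases le_total |x| 1 with h | h
    · have : |x| ^ n ≤ 1 := pow_le_one₀ (abs_nonneg x) h
      have : 0 ≤ (x ^ (2 * j)) ^ n := by positivity
      linarith
    · have h2 : x ^ (2 * j) = |x| ^ (2 * j) := by rw [pow_mul, pow_mul, sq_abs]
      have h3 : |x| ≤ |x| ^ (2 * j) := le_self_pow₀ h (by omega)
      rw [h2]
      linarith [pow_le_pow_left₀ (abs_nonneg x) h3 n]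
  have h2 := Real.pow_div_factorial_le_exp (T * x ^ (2 * j)) (by positivity) n
  have hf : (0 : ℝ) < n.factorial := by positivity
  have hTn : 0 < T ^ n := by positivity
  have h3 : (x ^ (2 * j)) ^ n * Real.exp (-(T * x ^ (2 * j))) ≤ n.factorial / T ^ n := by
    rw [Real.exp_neg, ← div_eq_mul_inv, div_le_div_iff₀ (Real.exp_pos _) hTn]
    rw [div_le_iff₀ hf, mul_pow] at h2
    linarith
  have h4 : Real.exp (-(T * x ^ (2 * j))) ≤ 1 := Real.exp_le_one_iff.2 (by nlinarith)
  calc |x| ^ n * Real.exp (-(T * x ^ (2 * j)))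
      ≤ (1 + (x ^ (2 * j)) ^ n) * Real.exp (-(T * x ^ (2 * j))) := by gcongr
    _ ≤ _ := by linarith

theorem polynomial_mul_exp_neg_bounded (j : ℕ) (hj : 1 ≤ j) {T : ℝ} (hT : 0 < T)
    (P : Polynomial ℝ) :
    ∃ C : ℝ, ∀ x : ℝ, |P.eval x * Real.exp (-(T * x ^ (2 * j)))| ≤ C := by
  induction P using Polynomial.induction_on' with
  | add p q hp hq =>
    obtain ⟨a, ha⟩ := hp
    obtain ⟨b, hb⟩ := hq
    refine ⟨a + b, fun x => ?_⟩
    rw [Polynomial.eval_add, add_mul]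
    exact (abs_add_le _ _).trans (add_le_add (ha x) (hb x))
  | monomial n c =>
    obtain ⟨a, ha⟩ := pow_mul_exp_neg_bounded j hj hT n
    refine ⟨|c| * a, fun x => ?_⟩
    rw [Polynomial.eval_monomial, abs_mul, abs_mul, abs_pow, mul_assoc,
      abs_of_pos (Real.exp_pos _)]
    exact mul_le_mul_of_nonneg_left (ha x) (abs_nonneg c)

theorem iteratedDeriv_exp_neg_pow (j : ℕ) (T : ℝ) (n : ℕ) :
    ∃ P : Polynomial ℝ,
      iteratedDeriv n (fun x : ℝ => ((Real.exp (-(T * x ^ (2 * j))) : ℝ) : ℂ)) =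
        fun x => ((P.eval x * Real.exp (-(T * x ^ (2 * j))) : ℝ) : ℂ) := by
  induction n with
  | zero => exact ⟨1, by simp⟩
  | succ n ih =>
    obtain ⟨P, hP⟩ := ih
    refine ⟨Polynomial.derivative P +
      P * (Polynomial.C (-(T * (2 * j : ℕ))) * Polynomial.X ^ (2 * j - 1)), ?_⟩
    rw [iteratedDeriv_succ, hP]
    funext x
    have h1 : HasDerivAt (fun x : ℝ => Real.exp (-(T * x ^ (2 * j))))
        (Real.exp (-(T * x ^ (2 * j))) * (-(T * ((2 * j : ℕ) * x ^ (2 * j - 1))))) x :=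
      (((hasDerivAt_pow (2 * j) x).const_mul T).neg).exp
    have h2 := ((P.hasDerivAt x).mul h1).ofReal_comp
    refine (HasDerivAt.deriv h2).trans ?_
    simp only [Polynomial.eval_add, Polynomial.eval_mul, Polynomial.eval_C, Polynomial.eval_pow,
      Polynomial.eval_X]
    congr 1
    ring

/-- The Schwartz function `exp(−T k^{2j})`. -/
def expProfile (j : ℕ) (hj : 1 ≤ j) (T : ℝ) (hT : 0 < T) : SchwartzMap ℝ ℂ where
  toFun x := ((Real.exp (-(T * x ^ (2 * j))) : ℝ) : ℂ)
  smooth' := by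
    have h : ContDiff ℝ (⊤ : ℕ∞) fun x : ℝ => Real.exp (-(T * x ^ (2 * j))) := by fun_prop
    exact Complex.ofRealCLM.contDiff.comp h
  decay' k n := by
    obtain ⟨P, hP⟩ := iteratedDeriv_exp_neg_pow j T n
    obtain ⟨C, hC⟩ := polynomial_mul_exp_neg_bounded j hj hT (Polynomial.X ^ k * P)
    refine ⟨C, fun x => ?_⟩
    rw [norm_iteratedFDeriv_eq_norm_iteratedDeriv, hP, Complex.norm_real]
    refine le_of_eq_of_le ?_ (hC x)
    simp [abs_mul, mul_assoc]

/-- The one-dimensional kernel with Fourier transform `exp(−T k^{2j})`. -/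
def expKernel (j : ℕ) (T x : ℝ) : ℝ :=
  ∫ k : ℝ, Real.exp (-(T * k ^ (2 * j))) * Real.cos (2 * Real.pi * (k * x))

theorem expProfile_apply (j : ℕ) (hj : 1 ≤ j) (T : ℝ) (hT : 0 < T) (x : ℝ) :
    expProfile j hj T hT x = ((Real.exp (-(T * x ^ (2 * j))) : ℝ) : ℂ) := rfl

theorem integrable_exp_neg_pow (j : ℕ) (hj : 1 ≤ j) {T : ℝ} (hT : 0 < T) :
    Integrable fun k : ℝ => Real.exp (-(T * k ^ (2 * j))) :=
  (expProfile j hj T hT).integrable.re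

theorem integrable_exp_neg_pow_mul_cos (j : ℕ) (hj : 1 ≤ j) {T : ℝ} (hT : 0 < T) (x : ℝ) :
    Integrable fun k : ℝ =>
      Real.exp (-(T * k ^ (2 * j))) * Real.cos (2 * Real.pi * (k * x)) :=
  (integrable_exp_neg_pow j hj hT).mul_bdd (c := 1)
    (by fun_prop) (Filter.Eventually.of_forall fun k => Real.abs_cos_le_one _)

theorem integrable_exp_neg_pow_mul_sin (j : ℕ) (hj : 1 ≤ j) {T : ℝ} (hT : 0 < T) (x : ℝ) :
    Integrable fun k : ℝ =>
      Real.exp (-(T * k ^ (2 * j))) * Real.sin (2 * Real.pi * (k * x)) :=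
  (integrable_exp_neg_pow j hj hT).mul_bdd (c := 1)
    (by fun_prop) (Filter.Eventually.of_forall fun k => Real.abs_sin_le_one _)

theorem integral_exp_neg_pow_mul_sin (j : ℕ) (T x : ℝ) :
    ∫ k : ℝ, Real.exp (-(T * k ^ (2 * j))) * Real.sin (2 * Real.pi * (k * x)) = 0 := by
  have h := integral_neg_eq_self
    (fun k : ℝ => Real.exp (-(T * k ^ (2 * j))) * Real.sin (2 * Real.pi * (k * x))) volume
  have h2 : ∀ k : ℝ, Real.exp (-(T * (-k) ^ (2 * j))) * Real.sin (2 * Real.pi * (-k * x)) =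
      -(Real.exp (-(T * k ^ (2 * j))) * Real.sin (2 * Real.pi * (k * x))) := by
    intro k
    rw [show 2 * Real.pi * (-k * x) = -(2 * Real.pi * (k * x)) by ring, Real.sin_neg,
      Even.neg_pow (even_two_mul j)]
    ring
  simp only [h2, integral_neg] at h
  linarith

open FourierTransform in
theorem fourierInv_expProfile (j : ℕ) (hj : 1 ≤ j) (T : ℝ) (hT : 0 < T) (x : ℝ) :
    (𝓕⁻ (expProfile j hj T hT)) x = (expKernel j T x : ℂ) := by
  rw [SchwartzMap.fourierInv_coe, Real.fourierInv_eq']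
  have h : ∀ k : ℝ, Complex.exp (((2 * Real.pi * inner ℝ k x : ℝ) : ℂ) * Complex.I) •
      expProfile j hj T hT k =
      ((Real.exp (-(T * k ^ (2 * j))) * Real.cos (2 * Real.pi * (k * x)) : ℝ) : ℂ) +
      ((Real.exp (-(T * k ^ (2 * j))) * Real.sin (2 * Real.pi * (k * x)) : ℝ) : ℂ) *
        Complex.I := by
    intro k
    rw [expProfile_apply, Complex.exp_mul_I, ← Complex.ofReal_cos, ← Complex.ofReal_sin]
    simp only [RCLike.inner_apply, conj_trivial, smul_eq_mul]
    push_cast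
    rw [mul_comm (x : ℂ) k]
    ring
  simp only [h]
  rw [integral_add, integral_mul_const, integral_complex_ofReal, integral_complex_ofReal,
    integral_exp_neg_pow_mul_sin, expKernel]
  · simp
  · exact (integrable_exp_neg_pow_mul_cos j hj hT x).ofReal
  · exact (integrable_exp_neg_pow_mul_sin j hj hT x).ofReal.mul_const _

theorem continuous_expKernel (j : ℕ) (hj : 1 ≤ j) {T : ℝ} (hT : 0 < T) :
    Continuous (expKernel j T) := by
  have h : expKernel j T = fun x => (FourierTransform.fourierInv (expProfile j hj T hT) x).re := by
    funext x
    rw [fourierInv_expProfile, Complex.ofReal_re]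
  rw [h]
  exact Complex.continuous_re.comp (SchwartzMap.continuous _)

open FourierTransform in
theorem integral_expKernel_mul (j : ℕ) (hj : 1 ≤ j) {s t : ℝ} (hs : 0 < s) (ht : 0 < t) (x : ℝ) :
    ∫ y, expKernel j s y * expKernel j t (x - y) = expKernel j (s + t) x := by
  have h1 : SchwartzMap.convolution (ContinuousLinearMap.mul ℂ ℂ) (𝓕⁻ (expProfile j hj s hs))
      (𝓕⁻ (expProfile j hj t ht)) = 𝓕⁻ (expProfile j hj (s + t) (add_pos hs ht)) := by
    rw [← FourierTransform.fourierInv_fourier_eq (F := SchwartzMap ℝ ℂ)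
      (SchwartzMap.convolution (ContinuousLinearMap.mul ℂ ℂ) (𝓕⁻ (expProfile j hj s hs))
        (𝓕⁻ (expProfile j hj t ht))), SchwartzMap.fourier_convolution]
    congr 1
    ext k
    simp only [FourierTransform.fourier_fourierInv_eq, SchwartzMap.pairing_apply_apply,
      ContinuousLinearMap.mul_apply', expProfile_apply]
    rw [← Complex.ofReal_mul, ← Real.exp_add]
    congr 2
    ring
  have h2 := DFunLike.congr_fun h1 x
  rw [SchwartzMap.convolution_apply, fourierInv_expProfile] at h2
  simp only [convolution_def, ContinuousLinearMap.mul_apply', fourierInv_expProfile] at h2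
  simp only [← Complex.ofReal_mul] at h2
  rw [integral_complex_ofReal] at h2
  exact_mod_cast h2

theorem expKernel_scaling (j : ℕ) {m : ℝ} (hm : 0 < m) (x : ℝ) :
    expKernel j ((m ^ (2 * j))⁻¹) x = m * expKernel j 1 (m * x) := by
  have h := Measure.integral_comp_mul_left
    (fun k : ℝ => Real.exp (-(1 * k ^ (2 * j))) * Real.cos (2 * Real.pi * (k * (m * x)))) m⁻¹
  rw [inv_inv, abs_of_pos hm, smul_eq_mul] at h
  rw [expKernel, expKernel, ← h]
  congr 1
  funext k
  congr 3
  · rw [mul_pow, inv_pow, one_mul]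
  · field_simp

theorem integrable_expKernel_pow (j : ℕ) (hj : 1 ≤ j) {T : ℝ} (hT : 0 < T) (n : ℕ) :
    Integrable fun x : ℝ => |expKernel j T x| * |x| ^ n := by
  have h := SchwartzMap.integrable_pow_mul volume
    (FourierTransform.fourierInv (expProfile j hj T hT)) n
  refine h.congr (Filter.Eventually.of_forall fun x => ?_)
  simp only [fourierInv_expProfile, Complex.norm_real, Real.norm_eq_abs]
  ring

theorem integrable_expKernel_rpow (j : ℕ) (hj : 1 ≤ j) {T : ℝ} (hT : 0 < T) {a : ℝ}
    (ha : 0 ≤ a) :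
    Integrable fun x : ℝ => |expKernel j T x| * |x| ^ a := by
  have hc := continuous_expKernel j hj hT
  refine ((integrable_expKernel_pow j hj hT 0).add
    (integrable_expKernel_pow j hj hT ⌈a⌉₊)).mono' ?_ (Filter.Eventually.of_forall fun x => ?_)
  · exact (hc.abs.mul (continuous_abs.rpow_const fun _ => Or.inr ha)).aestronglyMeasurable
  · have h : |x| ^ a ≤ 1 + |x| ^ ⌈a⌉₊ := by
      rcases le_total |x| 1 with h | h
      · have := Real.rpow_le_one (abs_nonneg x) h ha
        have : 0 ≤ |x| ^ ⌈a⌉₊ := by positivity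
        linarith
      · have := Real.rpow_le_rpow_of_exponent_le h (Nat.le_ceil a)
        rw [Real.rpow_natCast] at this
        linarith
    rw [Real.norm_eq_abs, abs_of_nonneg (by positivity)]
    simp only [Pi.add_apply, pow_zero]
    rw [← mul_add]
    gcongr

theorem integral_expKernel_rpow (j : ℕ) {m : ℝ} (hm : 0 < m) (a : ℝ) :
    ∫ x : ℝ, |expKernel j ((m ^ (2 * j))⁻¹) x| * |x| ^ a =
      (m⁻¹) ^ a * ∫ x : ℝ, |expKernel j 1 x| * |x| ^ a := by
  have h := Measure.integral_comp_mul_left (fun x : ℝ => |expKernel j 1 x| * |x| ^ a) m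
  rw [abs_of_pos (inv_pos.2 hm), smul_eq_mul] at h
  have h2 : ∀ x : ℝ, |expKernel j ((m ^ (2 * j))⁻¹) x| * |x| ^ a =
      m * (m⁻¹) ^ a * (|expKernel j 1 (m * x)| * |m * x| ^ a) := by
    intro x
    rw [expKernel_scaling j hm, abs_mul, abs_mul, abs_of_pos hm,
      Real.mul_rpow hm.le (abs_nonneg x), Real.inv_rpow hm.le]
    have : m ^ a ≠ 0 := (Real.rpow_pos_of_pos hm a).ne'
    field_simp
  simp only [h2]
  rw [integral_const_mul, h]
  field_simp

theorem integral_expKernel_rpow_eq (j : ℕ) (hj : 1 ≤ j) {t : ℝ} (ht : 0 < t) (a : ℝ) :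
    ∫ x : ℝ, |expKernel j t x| * |x| ^ a =
      (t ^ ((2 * j : ℕ) : ℝ)⁻¹) ^ a * ∫ x : ℝ, |expKernel j 1 x| * |x| ^ a := by
  have hm : 0 < (t ^ ((2 * j : ℕ) : ℝ)⁻¹)⁻¹ := by positivity
  have h := integral_expKernel_rpow j hm a
  rwa [inv_inv, inv_pow, inv_inv, Real.rpow_inv_natCast_pow ht.le (by omega)] at h

/-! ### The parabolic kernel -/

theorem psiK_eq {t : ℝ} (ht : 0 < t) (x : ℝ × ℝ) :
    psiK t x = expKernel 2 t x.1 * expKernel 1 t x.2 := by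
  have h : ∀ k : ℝ × ℝ, Real.exp (-(t * (k.1 ^ 4 + k.2 ^ 2))) *
      Real.cos (2 * Real.pi * (k.1 * x.1 + k.2 * x.2)) =
      (Real.exp (-(t * k.1 ^ (2 * 2))) * Real.cos (2 * Real.pi * (k.1 * x.1))) *
        (Real.exp (-(t * k.2 ^ (2 * 1))) * Real.cos (2 * Real.pi * (k.2 * x.2))) -
      (Real.exp (-(t * k.1 ^ (2 * 2))) * Real.sin (2 * Real.pi * (k.1 * x.1))) *
        (Real.exp (-(t * k.2 ^ (2 * 1))) * Real.sin (2 * Real.pi * (k.2 * x.2))) := by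
    intro k
    rw [show -(t * (k.1 ^ 4 + k.2 ^ 2)) = -(t * k.1 ^ (2 * 2)) + -(t * k.2 ^ (2 * 1)) by ring,
      Real.exp_add, mul_add, Real.cos_add]
    ring
  rw [psiK]
  simp only [h]
  rw [Measure.volume_eq_prod, integral_sub,
    integral_prod_mul
      (fun k => Real.exp (-(t * k ^ (2 * 2))) * Real.cos (2 * Real.pi * (k * x.1)))
      (fun k => Real.exp (-(t * k ^ (2 * 1))) * Real.cos (2 * Real.pi * (k * x.2))),
    integral_prod_mul
      (fun k => Real.exp (-(t * k ^ (2 * 2))) * Real.sin (2 * Real.pi * (k * x.1)))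
      (fun k => Real.exp (-(t * k ^ (2 * 1))) * Real.sin (2 * Real.pi * (k * x.2))),
    integral_exp_neg_pow_mul_sin, zero_mul, sub_zero, expKernel, expKernel]
  · exact (integrable_exp_neg_pow_mul_cos 2 one_le_two ht _).mul_prod
      (integrable_exp_neg_pow_mul_cos 1 le_rfl ht _)
  · exact (integrable_exp_neg_pow_mul_sin 2 one_le_two ht _).mul_prod
      (integrable_exp_neg_pow_mul_sin 1 le_rfl ht _)

theorem continuous_psiK {t : ℝ} (ht : 0 < t) : Continuous (psiK t) := by
  rw [funext (psiK_eq ht)]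
  exact ((continuous_expKernel 2 one_le_two ht).comp continuous_fst).mul
    ((continuous_expKernel 1 le_rfl ht).comp continuous_snd)

theorem integral_psiK_mul {s t : ℝ} (hs : 0 < s) (ht : 0 < t) (x : ℝ × ℝ) :
    ∫ y, psiK s y * psiK t (x - y) = psiK (s + t) x := by
  have h : ∀ y : ℝ × ℝ, psiK s y * psiK t (x - y) =
      (expKernel 2 s y.1 * expKernel 2 t (x.1 - y.1)) *
        (expKernel 1 s y.2 * expKernel 1 t (x.2 - y.2)) := by
    intro y
    rw [psiK_eq hs, psiK_eq ht, Prod.fst_sub, Prod.snd_sub]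
    ring
  simp only [h]
  rw [Measure.volume_eq_prod,
    integral_prod_mul (fun y => expKernel 2 s y * expKernel 2 t (x.1 - y))
      (fun y => expKernel 1 s y * expKernel 1 t (x.2 - y)),
    integral_expKernel_mul 2 one_le_two hs ht, integral_expKernel_mul 1 le_rfl hs ht,
    psiK_eq (add_pos hs ht)]

theorem pdist_nonneg (x y : ℝ × ℝ) : 0 ≤ pdist x y := by
  unfold pdist
  positivity

theorem pdist_sub_zero (x y : ℝ × ℝ) : pdist (x - y) 0 = pdist x y := by
  simp [pdist]

theorem continuous_pdist_left (y : ℝ × ℝ) : Continuous fun x => pdist x y := by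
  unfold pdist
  fun_prop

theorem add_rpow_le_two_rpow_mul {x y a : ℝ} (hx : 0 ≤ x) (hy : 0 ≤ y) (ha : 0 ≤ a) :
    (x + y) ^ a ≤ 2 ^ a * (x ^ a + y ^ a) := by
  wlog h : x ≤ y generalizing x y
  · rw [add_comm x, add_comm (x ^ a)]
    exact this hy hx (le_of_not_ge h)
  calc (x + y) ^ a ≤ (2 * y) ^ a := Real.rpow_le_rpow (by positivity) (by linarith) ha
    _ = 2 ^ a * y ^ a := Real.mul_rpow (by norm_num) hy
    _ ≤ _ := by
      have := Real.rpow_nonneg hx a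
      gcongr
      linarith

theorem psiK_moment {a : ℝ} (ha : 0 ≤ a) :
    ∃ C : ℝ, 0 ≤ C ∧ ∀ t : ℝ, 0 < t →
      Integrable (fun z => |psiK t z| * pdist z 0 ^ a) ∧
      ∫ z, |psiK t z| * pdist z 0 ^ a ≤ C * (t ^ (4⁻¹ : ℝ)) ^ a := by
  let J : ℕ → ℝ → ℝ := fun j b => ∫ x : ℝ, |expKernel j 1 x| * |x| ^ b
  have hJ : ∀ j b, 0 ≤ J j b := fun j b => integral_nonneg fun x => by positivity
  refine ⟨2 ^ a * (J 2 a * J 1 0 + J 2 0 * J 1 (a / 2)), ?_, fun t ht => ?_⟩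
  · have := hJ 2 a; have := hJ 1 0; have := hJ 2 0; have := hJ 1 (a / 2)
    positivity
  have i1 := (integrable_expKernel_rpow 2 one_le_two ht ha).mul_prod
    (integrable_expKernel_rpow 1 le_rfl ht le_rfl)
  have i2 := (integrable_expKernel_rpow 2 one_le_two ht le_rfl).mul_prod
    (integrable_expKernel_rpow 1 le_rfl ht (show 0 ≤ a / 2 by positivity))
  have i3 := (i1.add i2).const_mul (2 ^ a)
  rw [← Measure.volume_eq_prod] at i3
  have hle : ∀ z : ℝ × ℝ, |psiK t z| * pdist z 0 ^ a ≤
      2 ^ a * ((|expKernel 2 t z.1| * |z.1| ^ a) * (|expKernel 1 t z.2| * |z.2| ^ (0 : ℝ)) +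
        (|expKernel 2 t z.1| * |z.1| ^ (0 : ℝ)) * (|expKernel 1 t z.2| * |z.2| ^ (a / 2))) := by
    intro z
    have h := add_rpow_le_two_rpow_mul (abs_nonneg z.1) (Real.sqrt_nonneg |z.2|) ha
    have h2 : Real.sqrt |z.2| ^ a = |z.2| ^ (a / 2) := by
      rw [Real.sqrt_eq_rpow, ← Real.rpow_mul (abs_nonneg _)]
      congr 1
      ring
    have h3 : pdist z 0 = |z.1| + Real.sqrt |z.2| := by simp [pdist]
    rw [h2] at h
    rw [psiK_eq ht, abs_mul, h3, Real.rpow_zero, Real.rpow_zero]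
    calc |expKernel 2 t z.1| * |expKernel 1 t z.2| * (|z.1| + Real.sqrt |z.2|) ^ a
        ≤ |expKernel 2 t z.1| * |expKernel 1 t z.2| * (2 ^ a * (|z.1| ^ a + |z.2| ^ (a / 2))) := by
          gcongr
      _ = _ := by ring
  have hint : Integrable (fun z => |psiK t z| * pdist z 0 ^ a) := by
    refine i3.mono' ?_ (Filter.Eventually.of_forall fun z => ?_)
    · exact ((continuous_psiK ht).abs.mul
        ((continuous_pdist_left 0).rpow_const fun _ => Or.inr ha)).aestronglyMeasurable
    · rw [Real.norm_eq_abs, abs_of_nonneg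
        (mul_nonneg (abs_nonneg _) (Real.rpow_nonneg (pdist_nonneg _ _) _))]
      exact hle z
  refine ⟨hint, (integral_mono hint i3 hle).trans (le_of_eq ?_)⟩
  simp only [Pi.add_apply]
  rw [integral_const_mul, Measure.volume_eq_prod, integral_add i1 i2,
    integral_prod_mul (fun x => |expKernel 2 t x| * |x| ^ a)
      (fun x => |expKernel 1 t x| * |x| ^ (0 : ℝ)),
    integral_prod_mul (fun x => |expKernel 2 t x| * |x| ^ (0 : ℝ))
      (fun x => |expKernel 1 t x| * |x| ^ (a / 2)),
    integral_expKernel_rpow_eq 2 one_le_two ht, integral_expKernel_rpow_eq 2 one_le_two ht,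
    integral_expKernel_rpow_eq 1 le_rfl ht, integral_expKernel_rpow_eq 1 le_rfl ht]
  have e1 : (t ^ ((2 * 2 : ℕ) : ℝ)⁻¹) = t ^ (4⁻¹ : ℝ) := by norm_num
  have e2 : (t ^ ((2 * 1 : ℕ) : ℝ)⁻¹) ^ (a / 2) = (t ^ (4⁻¹ : ℝ)) ^ a := by
    rw [← Real.rpow_mul ht.le, ← Real.rpow_mul ht.le]
    congr 1
    push_cast
    ring
  rw [e1, e2, Real.rpow_zero, Real.rpow_zero]
  simp only [J]
  ring

theorem integrable_psiK {t : ℝ} (ht : 0 < t) : Integrable (psiK t) := by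
  obtain ⟨C, -, hC⟩ := psiK_moment (le_refl (0 : ℝ))
  have h := (hC t ht).1
  simp only [Real.rpow_zero, mul_one] at h
  exact (integrable_norm_iff (continuous_psiK ht).aestronglyMeasurable).1 h

/-! ### Mollification of bounded continuous functions -/

/-- Continuity and boundedness of a scalar field. -/
def BddContinuous (g : ℝ × ℝ → ℝ) : Prop := Continuous g ∧ ∃ B : ℝ, ∀ x, |g x| ≤ B

theorem BddContinuous.sub {g h : ℝ × ℝ → ℝ} (hg : BddContinuous g) (hh : BddContinuous h) :
    BddContinuous fun x => g x - h x := by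
  obtain ⟨hg, B, hB⟩ := hg
  obtain ⟨hh, D, hD⟩ := hh
  exact ⟨hg.sub hh, B + D, fun x => (abs_sub _ _).trans (add_le_add (hB x) (hD x))⟩

theorem integrable_psiK_sub {t : ℝ} (ht : 0 < t) (x : ℝ × ℝ) :
    Integrable fun y => psiK t (x - y) :=
  (integrable_psiK ht).comp_sub_left x

theorem BddContinuous.integrable_psiK_mul {g : ℝ × ℝ → ℝ} (hg : BddContinuous g) {t : ℝ}
    (ht : 0 < t) (x : ℝ × ℝ) : Integrable fun y => psiK t (x - y) • g y := by
  obtain ⟨hg, B, hB⟩ := hg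
  exact (integrable_psiK_sub ht x).mul_bdd (c := B) hg.aestronglyMeasurable
    (Filter.Eventually.of_forall hB)

theorem mollify_eq_integral_sub (t : ℝ) (g : ℝ × ℝ → ℝ) (x : ℝ × ℝ) :
    mollify t g x = ∫ u, psiK t u * g (x - u) := by
  rw [mollify, ← integral_sub_left_eq_self (fun u => psiK t u * g (x - u)) volume x]
  simp

theorem BddContinuous.mollify_sub {g h : ℝ × ℝ → ℝ} (hg : BddContinuous g)
    (hh : BddContinuous h) {t : ℝ} (ht : 0 < t) (x : ℝ × ℝ) :
    mollify t (fun y => g y - h y) x = mollify t g x - mollify t h x := by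
  rw [mollify, mollify, mollify, ← integral_sub (hg.integrable_psiK_mul ht x)
    (hh.integrable_psiK_mul ht x)]
  simp only [smul_sub]

/-- A uniform bound for the `L¹` norm of the kernels. -/
theorem exists_mollify_bound : ∃ K : ℝ, 0 ≤ K ∧ ∀ t : ℝ, 0 < t → ∀ (g : ℝ × ℝ → ℝ) (B : ℝ),
    (∀ x, |g x| ≤ B) → ∀ x, |mollify t g x| ≤ K * B := by
  obtain ⟨C, hC0, hC⟩ := psiK_moment (le_refl (0 : ℝ))
  refine ⟨C, hC0, fun t ht g B hB x => ?_⟩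
  have h := (hC t ht).2
  simp only [Real.rpow_zero, mul_one] at h
  have hB0 : 0 ≤ B := (abs_nonneg _).trans (hB 0)
  rw [mollify_eq_integral_sub, ← Real.norm_eq_abs]
  refine (norm_integral_le_of_norm_le ((integrable_psiK ht).abs.mul_const B)
    (Filter.Eventually.of_forall fun u => ?_)).trans ?_
  · rw [norm_mul, Real.norm_eq_abs, Real.norm_eq_abs]
    exact mul_le_mul_of_nonneg_left (hB _) (abs_nonneg _)
  · rw [integral_mul_const]
    exact mul_le_mul_of_nonneg_right h hB0

theorem BddContinuous.mollify {g : ℝ × ℝ → ℝ} (hg : BddContinuous g) {t : ℝ} (ht : 0 < t) :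
    BddContinuous (mollify t g) := by
  obtain ⟨K, -, hK⟩ := exists_mollify_bound
  obtain ⟨hg, B, hB⟩ := hg
  refine ⟨?_, K * B, hK t ht g B hB⟩
  rw [funext (mollify_eq_integral_sub t g)]
  refine continuous_of_dominated (bound := fun u => |psiK t u| * B) ?_ ?_ ?_ ?_
  · exact fun x => ((continuous_psiK ht).mul
      (hg.comp (continuous_const.sub continuous_id))).aestronglyMeasurable
  · refine fun x => Filter.Eventually.of_forall fun u => ?_
    rw [norm_mul, Real.norm_eq_abs, Real.norm_eq_abs]
    exact mul_le_mul_of_nonneg_left (hB _) (abs_nonneg _)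
  · exact (integrable_psiK ht).abs.mul_const B
  · exact Filter.Eventually.of_forall fun u =>
      continuous_const.mul (hg.comp (continuous_id.sub continuous_const))

theorem BddContinuous.mollify_mollify {g : ℝ × ℝ → ℝ} (hg : BddContinuous g) {s t : ℝ}
    (hs : 0 < s) (ht : 0 < t) :
    _root_.mollify t (_root_.mollify s g) = _root_.mollify (s + t) g := by
  funext x
  obtain ⟨hg, B, hB⟩ := hg
  have hint : Integrable (Function.uncurry fun z u : ℝ × ℝ =>
      psiK t u * psiK s (z - u) * g (x - z)) (volume.prod volume) := by
    refine ((integrable_psiK ht).convolution_integrand (ContinuousLinearMap.mul ℝ ℝ)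
      (integrable_psiK hs)).mul_bdd (c := B) (g := fun p => g (x - p.1)) ?_ ?_
    · exact (hg.comp (continuous_const.sub continuous_fst)).aestronglyMeasurable
    · exact Filter.Eventually.of_forall fun p => hB _
  have h1 : ∀ z, psiK (s + t) z * g (x - z) =
      ∫ u, psiK t u * psiK s (z - u) * g (x - z) := by
    intro z
    rw [integral_mul_const, integral_psiK_mul ht hs, add_comm t s]
  rw [mollify_eq_integral_sub, mollify_eq_integral_sub]
  simp only [h1]
  rw [integral_integral_swap hint]
  congr 1
  funext u
  rw [mollify_eq_integral_sub, ← integral_sub_right_eq_self _ u, ← integral_const_mul]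
  congr 1
  funext z
  rw [mul_assoc, sub_sub, add_sub_cancel]

/-! ### Parabolic chains -/

theorem exists_pdist_chain (x y : ℝ × ℝ) : ∃ (m : ℕ) (z : ℕ → ℝ × ℝ),
    z 0 = x ∧ z m = y ∧ (∀ i, pdist (z (i + 1)) (z i) ≤ 1) ∧ (1 + m : ℝ) ≤ 3 + pdist y x ^ 2 := by
  set d := pdist y x with hd
  have hd0 : 0 ≤ d := pdist_nonneg _ _
  set m := ⌈d ^ 2⌉₊ + 1 with hm
  have hm0 : (0 : ℝ) < m := by positivity
  have hm1 : (1 : ℝ) ≤ m := by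
    rw [hm]
    push_cast
    linarith [(Nat.cast_nonneg ⌈d ^ 2⌉₊ : (0 : ℝ) ≤ _)]
  have hmd : d ^ 2 ≤ m := by
    rw [hm]
    push_cast
    linarith [Nat.le_ceil (d ^ 2)]
  have hmu : (m : ℝ) ≤ d ^ 2 + 2 := by
    rw [hm]
    push_cast
    linarith [Nat.ceil_lt_add_one (sq_nonneg d)]
  refine ⟨m, fun i => x + ((i : ℝ) / m) • (y - x), by simp, ?_, fun i => ?_, by linarith⟩
  · simp
  · have h1 : ((x + (((i + 1 : ℕ) : ℝ) / m) • (y - x)).1 - (x + ((i : ℝ) / m) • (y - x)).1) =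
        (y.1 - x.1) / m := by
      simp only [Prod.fst_add, Prod.smul_fst, Prod.fst_sub, smul_eq_mul]
      push_cast
      ring
    have h2 : ((x + (((i + 1 : ℕ) : ℝ) / m) • (y - x)).2 - (x + ((i : ℝ) / m) • (y - x)).2) =
        (y.2 - x.2) / m := by
      simp only [Prod.snd_add, Prod.smul_snd, Prod.snd_sub, smul_eq_mul]
      push_cast
      ring
    have hs1 : 1 ≤ Real.sqrt m := Real.one_le_sqrt.2 hm1
    have hs : Real.sqrt m ≤ m := Real.sqrt_le_iff.2 ⟨hm0.le, by nlinarith⟩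
    have hds : d ≤ Real.sqrt m := Real.le_sqrt_of_sq_le hmd
    rw [pdist, h1, h2, abs_div, abs_div, Nat.abs_cast, Real.sqrt_div (abs_nonneg _)]
    calc |y.1 - x.1| / m + Real.sqrt |y.2 - x.2| / Real.sqrt m
        ≤ |y.1 - x.1| / Real.sqrt m + Real.sqrt |y.2 - x.2| / Real.sqrt m := by gcongr
      _ = d / Real.sqrt m := by rw [← add_div, hd, pdist]
      _ ≤ 1 := (div_le_one (by linarith)).2 hds

theorem pow_add_mul_pow_le_add_pow {a c : ℝ} (ha : 0 ≤ a) (hc : 0 ≤ c) (r : ℕ) :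
    a ^ (r + 1) + (r + 1) * c * a ^ r ≤ (a + c) ^ (r + 1) := by
  induction r with
  | zero => simp
  | succ r ih =>
    have h := mul_le_mul_of_nonneg_left ih (add_nonneg ha hc)
    have h2 : 0 ≤ (r + 1) * c * a ^ r * c := by positivity
    rw [pow_succ' (a + c)]
    refine le_trans (le_of_sub_nonneg ?_) h
    push_cast
    ring_nf
    ring_nf at h2
    linarith

theorem le_sInf_mul {s : Set ℝ} (hs : s.Nonempty) (h0 : ∀ C ∈ s, 0 ≤ C) {a b : ℝ}
    (h : ∀ C ∈ s, a ≤ C * b) : a ≤ sInf s * b := by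
  have hc : IsClosed {C : ℝ | a ≤ C * b} :=
    isClosed_le continuous_const (continuous_id.mul continuous_const)
  exact closure_minimal (t := {C : ℝ | a ≤ C * b}) h hc (csInf_mem_closure hs ⟨0, h0⟩)

namespace PreSkeleton

variable {A : Finset ℝ} {Tb : A → Type*}
  [∀ β, NormedAddCommGroup (Tb β)] [∀ β, NormedSpace ℝ (Tb β)]

theorem skelNorm_nonneg (S : PreSkeleton A Tb) : 0 ≤ S.skelNorm :=
  Real.sInf_nonneg fun _ h => h.1

theorem ctyNorm_nonneg (S : PreSkeleton A Tb) (ord : ℝ) (V : ℝ × ℝ → (∀ γ : A, Tb γ) → ℝ) :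
    0 ≤ S.ctyNorm ord V :=
  Real.sInf_nonneg fun _ h => h.1

theorem IsSkeleton.isSkelBound_skelNorm {S : PreSkeleton A Tb} (hS : S.IsSkeleton) :
    S.IsSkelBound S.skelNorm := by
  intro β v x y h
  exact le_sInf_mul hS (fun _ h => h.1) fun _ hC => hC.2 β v x y h

theorem IsModelled.formContinuous_ctyNorm {S : PreSkeleton A Tb} {ord : ℝ}
    {V : ℝ × ℝ → (∀ γ : A, Tb γ) → ℝ} (hV : S.IsModelled ord V) :
    S.FormContinuous ord V (S.ctyNorm ord V) := by
  intro x y v h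
  exact le_sInf_mul hV.2.2.2 (fun _ h => h.1) fun _ hC => hC.2 x y v h

/-- The operator `Γ_β(x)` as a continuous linear map. -/
def applyL (S : PreSkeleton A Tb) (x : ℝ × ℝ) (β : A) : (∀ γ : A, Tb γ) →L[ℝ] Tb β :=
  ∑ γ : A, (S.mat x β γ).comp (ContinuousLinearMap.proj γ)

theorem applyL_apply (S : PreSkeleton A Tb) (x : ℝ × ℝ) (β : A) (v : ∀ γ : A, Tb γ) :
    S.applyL x β v = S.apply x β v := by
  simp [applyL, apply]

theorem exists_norm_apply_le (S : PreSkeleton A Tb) (x : ℝ × ℝ) :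
    ∃ K : ℝ, 0 ≤ K ∧ ∀ β v, ‖S.apply x β v‖ ≤ K * ‖v‖ := by
  refine ⟨∑ β, ‖S.applyL x β‖, Finset.sum_nonneg fun _ _ => norm_nonneg _, fun β v => ?_⟩
  rw [← applyL_apply]
  refine ((S.applyL x β).le_opNorm v).trans (mul_le_mul_of_nonneg_right ?_ (norm_nonneg v))
  exact Finset.single_le_sum (f := fun β => ‖S.applyL x β‖) (fun _ _ => norm_nonneg _)
    (Finset.mem_univ β)

theorem exists_norm_le_sum_apply (S : PreSkeleton A Tb) (x : ℝ × ℝ) :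
    ∃ K : ℝ, 0 ≤ K ∧ ∀ v, ‖v‖ ≤ K * ∑ β, ‖S.apply x β v‖ := by
  have h : ∀ β : A, ∃ K : ℝ, 0 ≤ K ∧ ∀ v, ‖v β‖ ≤ K * ∑ β, ‖S.apply x β v‖ := by
    intro β
    induction β using WellFoundedLT.induction with
    | _ β ih =>
      have ih2 : ∀ γ : A, ∃ K : ℝ, 0 ≤ K ∧ (γ < β → ∀ v, ‖v γ‖ ≤ K * ∑ β, ‖S.apply x β v‖) := by
        intro γ
        by_cases hγ : γ < β
        · obtain ⟨K, hK0, hK⟩ := ih γ hγ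
          exact ⟨K, hK0, fun _ => hK⟩
        · exact ⟨0, le_rfl, fun h => absurd h hγ⟩
      choose K hK0 hK using ih2
      refine ⟨1 + ∑ γ, ‖S.mat x β γ‖ * K γ, ?_, fun v => ?_⟩
      · exact add_nonneg zero_le_one
          (Finset.sum_nonneg fun γ _ => mul_nonneg (norm_nonneg _) (hK0 γ))
      · have e : v β = S.apply x β v - ∑ γ ∈ Finset.univ.erase β, S.mat x β γ (v γ) := by
          rw [apply, ← Finset.add_sum_erase _ _ (Finset.mem_univ β), S.diag]
          simp
        set s := ∑ β, ‖S.apply x β v‖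
        have hs : 0 ≤ s := Finset.sum_nonneg fun _ _ => norm_nonneg _
        have h1 : ‖S.apply x β v‖ ≤ s :=
          Finset.single_le_sum (f := fun β => ‖S.apply x β v‖) (fun _ _ => norm_nonneg _)
            (Finset.mem_univ β)
        have h2 : ‖∑ γ ∈ Finset.univ.erase β, S.mat x β γ (v γ)‖ ≤
            ∑ γ, ‖S.mat x β γ‖ * K γ * s := by
          refine (norm_sum_le _ _).trans ((Finset.sum_le_sum fun γ hγ => ?_).trans
            (Finset.sum_le_sum_of_subset_of_nonneg (Finset.subset_univ _) fun γ _ _ =>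
              mul_nonneg (mul_nonneg (norm_nonneg _) (hK0 γ)) hs))
          rcases lt_or_gt_of_ne (Finset.ne_of_mem_erase hγ) with hlt | hgt
          · refine ((S.mat x β γ).le_opNorm _).trans ?_
            rw [mul_assoc]
            exact mul_le_mul_of_nonneg_left (hK γ hlt v) (norm_nonneg _)
          · rw [S.upper x β γ hgt]
            simp
        rw [e, add_mul, one_mul, Finset.sum_mul]
        exact (norm_sub_le _ _).trans (add_le_add h1 h2)
  choose K hK0 hK using h
  refine ⟨∑ β, K β, Finset.sum_nonneg fun β _ => hK0 β, fun v => ?_⟩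
  have hs : 0 ≤ ∑ β, ‖S.apply x β v‖ := Finset.sum_nonneg fun _ _ => norm_nonneg _
  refine (pi_norm_le_iff_of_nonneg (mul_nonneg (Finset.sum_nonneg fun β _ => hK0 β) hs)).2
    fun β => (hK β v).trans (mul_le_mul_of_nonneg_right ?_ hs)
  exact Finset.single_le_sum (f := K) (fun β _ => hK0 β) (Finset.mem_univ β)

/-- The number of levels strictly below `β`. -/
def levelRank (β : A) : ℕ := (Finset.univ.filter fun γ : A => (γ : ℝ) < (β : ℝ)).card

theorem levelRank_lt {γ β : A} (h : (γ : ℝ) < (β : ℝ)) : levelRank γ < levelRank β := by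
  refine Finset.card_lt_card ((Finset.ssubset_iff_of_subset fun δ hδ => ?_).2 ⟨γ, ?_, ?_⟩)
  · simp only [Finset.mem_filter, Finset.mem_univ, true_and] at hδ ⊢
    exact hδ.trans h
  · simpa using h
  · simp

theorem levelRank_le (β : A) : levelRank β ≤ A.card - 1 := by
  have h : levelRank β < Fintype.card A :=
    Finset.card_lt_univ_of_notMem (x := β) (by simp)
  rw [Fintype.card_coe] at h
  omega

theorem IsSkelBound.norm_apply_chain_le {S : PreSkeleton A Tb} {L : ℝ} (hL : 0 ≤ L)
    (hS : S.IsSkelBound L) {z : ℕ → ℝ × ℝ} (hz : ∀ i, pdist (z (i + 1)) (z i) ≤ 1)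
    {v : ∀ γ : A, Tb γ} {s : ℝ} (hs : ∀ γ, ‖S.apply (z 0) γ v‖ ≤ s) (i : ℕ) (β : A) :
    ‖S.apply (z i) β v‖ ≤ s * ((1 + L) * (1 + i)) ^ levelRank β := by
  have hs0 : 0 ≤ s := (norm_nonneg _).trans (hs β)
  induction i generalizing β with
  | zero =>
    refine (hs β).trans (le_mul_of_one_le_right hs0 (one_le_pow₀ ?_))
    push_cast
    linarith
  | succ i ih =>
    set b : ℝ := (1 + L) * (1 + i) with hb
    have hb1 : 1 ≤ b := by nlinarith [(Nat.cast_nonneg i : (0 : ℝ) ≤ i)]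
    have h1 := hS β v (z i) (z (i + 1)) (hz i)
    have h2 : ‖S.apply (z (i + 1)) β v‖ ≤ s * b ^ levelRank β +
        L * ∑ γ : A, if (γ : ℝ) < (β : ℝ) then s * b ^ (levelRank β - 1) else 0 := by
      have h3 := norm_le_norm_add_norm_sub (S.apply (z i) β v) (S.apply (z (i + 1)) β v)
      rw [norm_sub_rev] at h3
      refine h3.trans (add_le_add (ih β) (h1.trans (mul_le_mul_of_nonneg_left
        (Finset.sum_le_sum fun γ _ => ?_) hL)))
      split_ifs with hγ
      · have h4 : pdist (z (i + 1)) (z i) ^ ((β : ℝ) - γ) ≤ 1 :=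
          Real.rpow_le_one (pdist_nonneg _ _) (hz i) (by linarith)
        calc _ ≤ 1 * ‖S.apply (z i) γ v‖ := by gcongr
          _ ≤ 1 * (s * b ^ levelRank γ) := by gcongr; exact ih γ
          _ ≤ _ := by
            rw [one_mul]
            have := levelRank_lt hγ
            gcongr ?_ * ?_ ^ ?_
            omega
      · exact le_rfl
    refine h2.trans ?_
    rw [← Finset.sum_filter, Finset.sum_const, nsmul_eq_mul]
    change s * b ^ levelRank β + L * ((levelRank β : ℝ) * (s * b ^ (levelRank β - 1))) ≤ _
    have e : (1 + L) * (1 + ((i + 1 : ℕ) : ℝ)) = b + (1 + L) := by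
      rw [hb]
      push_cast
      ring
    rw [e]
    rcases Nat.eq_zero_or_pos (levelRank β) with h0 | h0
    · rw [h0]
      simp
    · obtain ⟨r, hr⟩ := Nat.exists_eq_add_of_lt h0
      rw [zero_add] at hr
      have h5 := pow_add_mul_pow_le_add_pow (show 0 ≤ b by linarith)
        (show 0 ≤ 1 + L by linarith) r
      rw [hr, Nat.add_sub_cancel]
      push_cast
      have h6 : 0 ≤ ((r : ℝ) + 1) * b ^ r := by positivity
      calc s * b ^ (r + 1) + L * (((r : ℝ) + 1) * (s * b ^ r))
          = s * (b ^ (r + 1) + L * (((r : ℝ) + 1) * b ^ r)) := by ring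
        _ ≤ s * (b ^ (r + 1) + (r + 1) * (1 + L) * b ^ r) := by
          gcongr s * (_ + ?_)
          nlinarith
        _ ≤ _ := by gcongr

theorem IsSkelBound.norm_apply_chain_le_pow {S : PreSkeleton A Tb} {L : ℝ} (hL : 0 ≤ L)
    (hS : S.IsSkelBound L) {z : ℕ → ℝ × ℝ} (hz : ∀ i, pdist (z (i + 1)) (z i) ≤ 1)
    {v : ∀ γ : A, Tb γ} {s : ℝ} (hs : ∀ γ, ‖S.apply (z 0) γ v‖ ≤ s) {i m : ℕ} (him : i ≤ m)
    (β : A) :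
    ‖S.apply (z i) β v‖ ≤ s * ((1 + L) ^ (A.card - 1) * (1 + m) ^ (A.card - 1)) := by
  have hs0 : 0 ≤ s := (norm_nonneg _).trans (hs β)
  have hi : (i : ℝ) ≤ m := by exact_mod_cast him
  refine (hS.norm_apply_chain_le hL hz hs i β).trans (mul_le_mul_of_nonneg_left ?_ hs0)
  rw [← mul_pow]
  calc ((1 + L) * (1 + i)) ^ levelRank β ≤ ((1 + L) * (1 + m)) ^ levelRank β := by gcongr
    _ ≤ _ := by
      refine pow_le_pow_right₀ ?_ (levelRank_le β)
      nlinarith [(Nat.cast_nonneg m : (0 : ℝ) ≤ m)]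

theorem IsSkelBound.norm_apply_le {S : PreSkeleton A Tb} {L : ℝ} (hL : 0 ≤ L)
    (hS : S.IsSkelBound L) {x y : ℝ × ℝ} {v : ∀ γ : A, Tb γ} {s : ℝ}
    (hs : ∀ γ, ‖S.apply y γ v‖ ≤ s) (β : A) :
    ‖S.apply x β v‖ ≤
      s * ((1 + L) ^ (A.card - 1) * (3 + pdist x y ^ 2) ^ (A.card - 1)) := by
  have hs0 : 0 ≤ s := (norm_nonneg _).trans (hs β)
  obtain ⟨m, z, rfl, rfl, hz, hm⟩ := exists_pdist_chain y x
  refine (hS.norm_apply_chain_le_pow hL hz hs le_rfl β).trans ?_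
  gcongr

theorem FormContinuous.abs_sub_le {S : PreSkeleton A Tb} {L : ℝ} (hL : 0 ≤ L)
    (hS : S.IsSkelBound L) {ord : ℝ} {V : ℝ × ℝ → (∀ γ : A, Tb γ) → ℝ} {M : ℝ} (hM : 0 ≤ M)
    (hV : S.FormContinuous ord V M) {x y : ℝ × ℝ} {v : ∀ γ : A, Tb γ} {s : ℝ} (hs0 : 0 ≤ s)
    (hs : ∀ γ, ‖S.apply y γ v‖ ≤ s) :
    |V x v - V y v| ≤
      M * (1 + L) ^ (A.card - 1) * (A.card * s * (3 + pdist x y ^ 2) ^ (A.card - 1 + 1)) := by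
  obtain ⟨m, z, rfl, rfl, hz, hm⟩ := exists_pdist_chain y x
  have hstep : ∀ i < m, |V (z (i + 1)) v - V (z i) v| ≤
      M * (A.card * (s * ((1 + L) ^ (A.card - 1) * (1 + m) ^ (A.card - 1)))) := by
    intro i hi
    refine (hV (z i) (z (i + 1)) v (hz i)).trans (mul_le_mul_of_nonneg_left ?_ hM)
    calc _ ≤ ∑ _β : A, s * ((1 + L) ^ (A.card - 1) * (1 + (m : ℝ)) ^ (A.card - 1)) := by
          refine Finset.sum_le_sum fun β _ => ?_
          have h1 := Real.rpow_le_one (pdist_nonneg (z (i + 1)) (z i)) (hz i)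
            (le_max_right (ord - (β : ℝ)) 0)
          exact (mul_le_of_le_one_left (norm_nonneg _) h1).trans
            (hS.norm_apply_chain_le_pow hL hz hs hi.le β)
      _ = _ := by
          rw [Finset.sum_const, Finset.card_univ, Fintype.card_coe, nsmul_eq_mul]
  have htel : V (z m) v - V (z 0) v = ∑ i ∈ Finset.range m, (V (z (i + 1)) v - V (z i) v) :=
    (Finset.sum_range_sub (fun i => V (z i) v) m).symm
  rw [htel]
  refine (Finset.abs_sum_le_sum_abs _ _).trans ((Finset.sum_le_sum fun i hi =>
    hstep i (Finset.mem_range.1 hi)).trans ?_)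
  rw [Finset.sum_const, Finset.card_range, nsmul_eq_mul]
  calc (m : ℝ) * (M * (A.card * (s * ((1 + L) ^ (A.card - 1) * (1 + m) ^ (A.card - 1)))))
      = M * (1 + L) ^ (A.card - 1) * (A.card * s * ((1 + m) ^ (A.card - 1) * m)) := by ring
    _ ≤ M * (1 + L) ^ (A.card - 1) * (A.card * s * ((3 + pdist (z m) (z 0) ^ 2) ^ (A.card - 1)
          * (3 + pdist (z m) (z 0) ^ 2))) := by
        gcongr
        linarith
    _ = _ := by rw [← pow_succ (3 + pdist (z m) (z 0) ^ 2)]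

end PreSkeleton

theorem psiK_moment_sub {a : ℝ} (ha : 0 ≤ a) :
    ∃ C : ℝ, 0 ≤ C ∧ ∀ t : ℝ, 0 < t → ∀ x : ℝ × ℝ,
      Integrable (fun y => |psiK t (x - y)| * pdist x y ^ a) ∧
      ∫ y, |psiK t (x - y)| * pdist x y ^ a ≤ C * (t ^ (4⁻¹ : ℝ)) ^ a := by
  obtain ⟨C, hC0, hC⟩ := psiK_moment ha
  refine ⟨C, hC0, fun t ht x => ?_⟩
  simp only [← pdist_sub_zero x]
  exact ⟨(hC t ht).1.comp_sub_left x, (le_of_eq (integral_sub_left_eq_self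
    (fun z => |psiK t z| * pdist z 0 ^ a) volume x)).trans (hC t ht).2⟩

theorem integral_of_not_completeSpace {α E : Type*} [MeasurableSpace α] [NormedAddCommGroup E]
    [NormedSpace ℝ E] (hE : ¬CompleteSpace E) (μ : Measure α) (f : α → E) : ∫ x, f x ∂μ = 0 := by
  rw [integral_def, dif_neg hE]

theorem MollDistrib.app_eq_zero_of_not_completeSpace {E : Type*} [NormedAddCommGroup E]
    [NormedSpace ℝ E] (hE : ¬CompleteSpace E) (v : MollDistrib E) {T : ℝ} (hT : 0 < T)
    (x : ℝ × ℝ) : v.app T x = 0 := by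
  rw [← add_halves T, v.semigroup _ (half_pos hT) _ (half_pos hT)]
  exact integral_of_not_completeSpace hE _ _

namespace PreSkeleton

variable {A : Finset ℝ} {Tb : A → Type*}
  [∀ β, NormedAddCommGroup (Tb β)] [∀ β, NormedSpace ℝ (Tb β)]
  {S : PreSkeleton A Tb} {ord : ℝ} {V : ℝ × ℝ → (∀ γ : A, Tb γ) → ℝ}

theorem IsModelled.exists_abs_le (hV : S.IsModelled ord V) (x : ℝ × ℝ) :
    ∃ K : ℝ, ∀ w, |V x w| ≤ K * ‖w‖ := by
  obtain ⟨Mb, hMb0, hMb⟩ := hV.2.2.1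
  obtain ⟨K, hK0, hK⟩ := S.exists_norm_apply_le x
  refine ⟨∑ β, Mb β * K, fun w => (hMb x w).trans ?_⟩
  rw [Finset.sum_mul]
  refine Finset.sum_le_sum fun β _ => ?_
  rw [mul_assoc]
  exact mul_le_mul_of_nonneg_left (hK β w) (hMb0 β)

/-- A modelled distribution at a point, as a continuous linear form. -/
def IsModelled.toCLM (hV : S.IsModelled ord V) (x : ℝ × ℝ) : (∀ γ : A, Tb γ) →L[ℝ] ℝ :=
  (IsLinearMap.mk' (V x) (hV.1 x)).mkContinuousOfExistsBound (hV.exists_abs_le x)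

theorem IsModelled.toCLM_apply (hV : S.IsModelled ord V) (x : ℝ × ℝ) (w : ∀ γ : A, Tb γ) :
    hV.toCLM x w = V x w := rfl

theorem IsModelled.exists_local_bound (hS : S.IsSkeleton) (hV : S.IsModelled ord V)
    (x : ℝ × ℝ) : ∃ K : ℝ, ∀ y, pdist y x ≤ 1 → ∀ w, |V y w| ≤ K * ‖w‖ := by
  obtain ⟨Mb, hMb0, hMb⟩ := hV.2.2.1
  obtain ⟨K, hK0, hK⟩ := S.exists_norm_apply_le x
  refine ⟨∑ β, Mb β * (K * ((1 + S.skelNorm) ^ (A.card - 1) * (3 + 1 ^ 2) ^ (A.card - 1))),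
    fun y hy w => (hMb y w).trans ?_⟩
  rw [Finset.sum_mul]
  refine Finset.sum_le_sum fun β _ => ?_
  rw [mul_assoc]
  refine mul_le_mul_of_nonneg_left ?_ (hMb0 β)
  refine (hS.isSkelBound_skelNorm.norm_apply_le S.skelNorm_nonneg (x := y)
    (fun γ => hK γ w) β).trans ?_
  have := S.skelNorm_nonneg
  have := pdist_nonneg y x
  rw [mul_assoc, mul_assoc, mul_comm ‖w‖]
  gcongr

theorem IsModelled.continuous_apply (hS : S.IsSkeleton) (hV : S.IsModelled ord V)
    {w : ℝ × ℝ → ∀ γ : A, Tb γ} (hw : Continuous w) : Continuous fun x => V x (w x) := by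
  refine continuous_iff_continuousAt.2 fun x => ?_
  obtain ⟨K, hK⟩ := hV.exists_local_bound hS x
  have hd : ∀ᶠ y in nhds x, pdist y x ≤ 1 := by
    have h := (continuous_pdist_left x).tendsto x
    have h0 : pdist x x = 0 := by simp [pdist]
    rw [h0] at h
    exact (h.eventually_lt_const one_pos).mono fun _ h => h.le
  have h1 : Filter.Tendsto (fun y => V y (w y - w x)) (nhds x) (nhds 0) := by
    refine squeeze_zero_norm' (a := fun y => K * ‖w y - w x‖) (hd.mono fun y hy => hK y hy _) ?_
    have : Continuous fun y => K * ‖w y - w x‖ := by fun_prop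
    simpa using this.tendsto x
  have h2 := h1.add ((hV.2.1 (w x)).tendsto x)
  rw [zero_add] at h2
  refine h2.congr fun y => ?_
  rw [← (hV.1 y).map_add, sub_add_cancel]

theorem IsModelled.bddContinuous (hS : S.IsSkeleton) (hV : S.IsModelled ord V)
    {w : ℝ × ℝ → ∀ γ : A, Tb γ} (hw : Continuous w) {s : A → ℝ}
    (hs : ∀ β x, ‖S.apply x β (w x)‖ ≤ s β) : BddContinuous fun x => V x (w x) := by
  obtain ⟨Mb, hMb0, hMb⟩ := hV.2.2.1
  exact ⟨hV.continuous_apply hS hw, ∑ β, Mb β * s β, fun x => (hMb x _).trans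
    (Finset.sum_le_sum fun β _ => mul_le_mul_of_nonneg_left (hs β x) (hMb0 β))⟩

theorem IsSkelBound.integrable_psiK_smul {L : ℝ} (hL : 0 ≤ L) (hS : S.IsSkelBound L)
    {w : ℝ × ℝ → ∀ γ : A, Tb γ} (hw : Continuous w) {s : ℝ}
    (hs : ∀ β x, ‖S.apply x β (w x)‖ ≤ s) {t : ℝ} (ht : 0 < t) (x : ℝ × ℝ) :
    Integrable fun y => psiK t (x - y) • w y := by
  obtain ⟨K, hK0, hK⟩ := S.exists_norm_le_sum_apply x
  obtain ⟨_, -, h1⟩ := psiK_moment_sub (le_refl (0 : ℝ))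
  obtain ⟨_, -, h2⟩ := psiK_moment_sub (Nat.cast_nonneg (2 * (A.card - 1)) : (0 : ℝ) ≤ _)
  refine Integrable.mono' ((((h1 t ht x).1.add (h2 t ht x).1)).const_mul
    (K * ∑ _β : A, s * ((1 + L) ^ (A.card - 1) * 4 ^ (A.card - 1)))) ?_
    (Filter.Eventually.of_forall fun y => ?_)
  · exact (((continuous_psiK ht).comp (continuous_const.sub continuous_id)).smul
      hw).aestronglyMeasurable
  · set d := pdist x y
    have hd : 0 ≤ d := pdist_nonneg _ _
    have hpow : (3 + d ^ 2) ^ (A.card - 1) ≤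
        4 ^ (A.card - 1) * (1 + d ^ (2 * (A.card - 1))) := by
      rcases le_total d 1 with h | h
      · calc (3 + d ^ 2) ^ (A.card - 1) ≤ (4 : ℝ) ^ (A.card - 1) := by gcongr; nlinarith
          _ ≤ _ := le_mul_of_one_le_right (by positivity) (le_add_of_nonneg_right (by positivity))
      · calc (3 + d ^ 2) ^ (A.card - 1) ≤ (4 * d ^ 2) ^ (A.card - 1) := by gcongr; nlinarith
          _ = 4 ^ (A.card - 1) * d ^ (2 * (A.card - 1)) := by rw [mul_pow, ← pow_mul]
          _ ≤ _ := by gcongr; linarith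
    have hwy : ‖w y‖ ≤ K * ∑ _β : A, s * ((1 + L) ^ (A.card - 1) *
        (4 ^ (A.card - 1) * (1 + d ^ (2 * (A.card - 1))))) := by
      refine (hK (w y)).trans (mul_le_mul_of_nonneg_left (Finset.sum_le_sum fun β _ => ?_) hK0)
      have hs0 : 0 ≤ s := (norm_nonneg _).trans (hs β x)
      refine (hS.norm_apply_le hL (fun γ => hs γ y) β).trans ?_
      gcongr
    rw [norm_smul, Real.norm_eq_abs]
    refine (mul_le_mul_of_nonneg_left hwy (abs_nonneg _)).trans (le_of_eq ?_)
    simp only [Pi.add_apply, Real.rpow_zero, Real.rpow_natCast, Finset.sum_const, nsmul_eq_mul]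
    ring

theorem IsModelled.abs_sub_le (hA : A.Nonempty) (hS : S.IsSkeleton) (hV : S.IsModelled ord V)
    {l : ℝ} (hl0 : 0 < l) (hl1 : l ≤ 1) {x y : ℝ × ℝ} {w : ∀ γ : A, Tb γ}
    (hw : ∀ β, ‖S.apply y β w‖ ≤ l ^ (β : ℝ)) :
    |V x w - V y w| ≤ S.ctyNorm ord V * (1 + S.skelNorm) ^ (A.card - 1) *
      (∑ β : A, pdist x y ^ max (ord - (β : ℝ)) 0 * l ^ (β : ℝ) +
        A.card * 4 ^ A.card * (pdist x y ^ max ((2 * A.card : ℕ) : ℝ) (ord - A.min' hA) *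
          l ^ A.min' hA)) := by
  have hL := S.skelNorm_nonneg
  have hM := S.ctyNorm_nonneg ord V
  set d := pdist x y with hd
  have hd0 : 0 ≤ d := pdist_nonneg _ _
  have hsum : 0 ≤ ∑ β : A, d ^ max (ord - (β : ℝ)) 0 * l ^ (β : ℝ) :=
    Finset.sum_nonneg fun β _ => by positivity
  rcases le_or_gt d 1 with h | h
  · refine (hV.formContinuous_ctyNorm y x w h).trans ?_
    rw [mul_assoc]
    refine mul_le_mul_of_nonneg_left ?_ hM
    calc _ ≤ ∑ β : A, d ^ max (ord - (β : ℝ)) 0 * l ^ (β : ℝ) :=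
          Finset.sum_le_sum fun β _ => mul_le_mul_of_nonneg_left (hw β) (by positivity)
      _ ≤ ∑ β : A, d ^ max (ord - (β : ℝ)) 0 * l ^ (β : ℝ) +
          A.card * 4 ^ A.card * (d ^ max ((2 * A.card : ℕ) : ℝ) (ord - A.min' hA) *
            l ^ A.min' hA) := le_add_of_nonneg_right (by positivity)
      _ ≤ _ := le_mul_of_one_le_left (add_nonneg hsum (by positivity))
          (one_le_pow₀ (by linarith))
  · have hw' : ∀ β, ‖S.apply y β w‖ ≤ l ^ A.min' hA := fun β => (hw β).trans
      (Real.rpow_le_rpow_of_exponent_ge hl0 hl1 (A.min'_le β β.2))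
    refine (hV.formContinuous_ctyNorm.abs_sub_le hL hS.isSkelBound_skelNorm hM
      (by positivity) hw' (x := x)).trans (mul_le_mul_of_nonneg_left ?_ (by positivity))
    refine le_add_of_nonneg_of_le hsum ?_
    rw [Nat.sub_add_cancel hA.card_pos, ← hd]
    have h1 : (3 + d ^ 2) ^ A.card ≤
        4 ^ A.card * d ^ max ((2 * A.card : ℕ) : ℝ) (ord - A.min' hA) := by
      calc (3 + d ^ 2) ^ A.card ≤ (4 * d ^ 2) ^ A.card := by gcongr; nlinarith
        _ = 4 ^ A.card * d ^ ((2 * A.card : ℕ) : ℝ) := by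
          rw [mul_pow, ← pow_mul, Real.rpow_natCast]
        _ ≤ _ := by
          gcongr
          · exact h.le
          · exact le_max_left _ _
    calc A.card * l ^ A.min' hA * (3 + d ^ 2) ^ A.card
        ≤ A.card * l ^ A.min' hA *
          (4 ^ A.card * d ^ max ((2 * A.card : ℕ) : ℝ) (ord - A.min' hA)) := by gcongr
      _ = _ := by ring

end PreSkeleton

theorem rpow_mul_rpow_le_rpow {r l a b c : ℝ} (hr : 0 ≤ r) (hrl : r ≤ l) (hl0 : 0 < l)
    (hl1 : l ≤ 1) (ha : 0 ≤ a) (h : c ≤ a + b) : r ^ a * l ^ b ≤ l ^ c :=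
  calc r ^ a * l ^ b ≤ l ^ a * l ^ b := by gcongr
    _ = l ^ (a + b) := (Real.rpow_add hl0 a b).symm
    _ ≤ l ^ c := Real.rpow_le_rpow_of_exponent_ge hl0 hl1 h

/-- The commutator estimate behind the reconstruction theorem. -/
theorem exists_mollify_sub_le (A : Finset ℝ) (hA : A.Nonempty) (ord : ℝ) :
    ∃ C : ℝ, 0 ≤ C ∧
      ∀ (Tb : A → Type*) [∀ β, NormedAddCommGroup (Tb β)] [∀ β, NormedSpace ℝ (Tb β)]
        (S : PreSkeleton A Tb), S.IsSkeleton →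
        ∀ v : MollDistrib (∀ γ : A, Tb γ),
          (∀ (β : A) (x : ℝ × ℝ) (T : ℝ), 0 < T → T ≤ 1 →
            ‖S.apply x β (v.app T x)‖ ≤ (T ^ (4⁻¹ : ℝ)) ^ (β : ℝ)) →
        ∀ V : ℝ × ℝ → (∀ γ : A, Tb γ) → ℝ, S.IsModelled ord V →
          ∀ T t : ℝ, 0 < t → t ≤ T → T ≤ 1 → ∀ x,
            |mollify t (fun y => V y (v.app T y)) x - V x (v.app (T + t) x)| ≤
              C * (S.ctyNorm ord V * (1 + S.skelNorm) ^ (A.card - 1)) *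
                (T ^ (4⁻¹ : ℝ)) ^ ord := by
  set P := max ((2 * A.card : ℕ) : ℝ) (ord - A.min' hA) with hP
  have hP0 : 0 ≤ P := (Nat.cast_nonneg _).trans (le_max_left _ _)
  choose c hc0 hc using fun β : A => psiK_moment_sub (le_max_right (ord - (β : ℝ)) 0)
  obtain ⟨D, hD0, hD⟩ := psiK_moment_sub hP0
  have hC0 : 0 ≤ ∑ β, c β + A.card * 4 ^ A.card * D :=
    add_nonneg (Finset.sum_nonneg fun β _ => hc0 β) (by positivity)
  refine ⟨_, hC0, fun Tb _ _ S hS v hv V hV T t ht htT hT1 x => ?_⟩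
  have hL := S.skelNorm_nonneg
  have hM := S.ctyNorm_nonneg ord V
  have hT : 0 < T := ht.trans_le htT
  set l := T ^ (4⁻¹ : ℝ) with hl
  set r := t ^ (4⁻¹ : ℝ) with hr
  have hl0 : 0 < l := Real.rpow_pos_of_pos hT _
  have hl1 : l ≤ 1 := Real.rpow_le_one hT.le hT1 (by norm_num)
  have hr0 : 0 ≤ r := Real.rpow_nonneg ht.le _
  have hrl : r ≤ l := Real.rpow_le_rpow ht.le htT (by norm_num)
  set Q := S.ctyNorm ord V * (1 + S.skelNorm) ^ (A.card - 1) with hQ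
  have hQ0 : 0 ≤ Q := by positivity
  by_cases hE : CompleteSpace (∀ γ : A, Tb γ)
  swap
  · have h0 : ∀ y, V y 0 = 0 := fun y => (hV.1 y).map_zero
    simp only [v.app_eq_zero_of_not_completeSpace hE hT,
      v.app_eq_zero_of_not_completeSpace hE (add_pos hT ht), h0, mollify, smul_zero,
      integral_zero, sub_zero, abs_zero]
    positivity
  have hs : ∀ β y, ‖S.apply y β (v.app T y)‖ ≤ l ^ A.min' hA := fun β y =>
    (hv β y T hT hT1).trans (Real.rpow_le_rpow_of_exponent_ge hl0 hl1 (A.min'_le β β.2))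
  have hint := hS.isSkelBound_skelNorm.integrable_psiK_smul hL (v.cont T hT) hs ht x
  have hF : BddContinuous fun y => V y (v.app T y) :=
    hV.bddContinuous hS (v.cont T hT) (s := fun β => l ^ (β : ℝ))
      fun β y => hv β y T hT hT1
  have e1 : V x (v.app (T + t) x) = ∫ y, psiK t (x - y) • V x (v.app T y) := by
    rw [v.semigroup T hT t ht, mollify, ← hV.toCLM_apply,
      ← ContinuousLinearMap.integral_comp_comm _ hint]
    simp only [hV.toCLM_apply, (hV.1 x).map_smul]
  have hint2 : Integrable fun y => psiK t (x - y) • V x (v.app T y) := by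
    simpa only [hV.toCLM_apply, (hV.1 x).map_smul] using (hV.toCLM x).integrable_comp hint
  rw [e1, mollify, ← integral_sub (hF.integrable_psiK_mul ht x) hint2, ← Real.norm_eq_abs]
  have hb1 : Integrable fun y => ∑ β : A, (|psiK t (x - y)| *
      pdist x y ^ max (ord - (β : ℝ)) 0) * l ^ (β : ℝ) :=
    integrable_finsetSum _ fun β _ => ((hc β t ht x).1.mul_const _)
  have hb2 := ((hD t ht x).1.mul_const (l ^ A.min' hA)).const_mul (A.card * 4 ^ A.card : ℝ)
  refine (norm_integral_le_of_norm_le ((hb1.add hb2).const_mul Q)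
    (Filter.Eventually.of_forall fun y => ?_)).trans ?_
  · rw [← smul_sub, norm_smul, Real.norm_eq_abs, Real.norm_eq_abs, abs_sub_comm]
    refine (mul_le_mul_of_nonneg_left (hV.abs_sub_le hA hS hl0 hl1 (x := x)
      fun β => hv β y T hT hT1) (abs_nonneg _)).trans (le_of_eq ?_)
    rw [← hP, ← hQ, Pi.add_apply, mul_left_comm, mul_add, Finset.mul_sum]
    congr 2
    · exact Finset.sum_congr rfl fun β _ => by ring
    · ring
  · rw [integral_const_mul]
    simp only [Pi.add_apply]
    rw [integral_add hb1 hb2, integral_finsetSum _ fun β _ => (hc β t ht x).1.mul_const _,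
      integral_const_mul, integral_mul_const, mul_comm _ Q, mul_assoc Q, add_mul, Finset.sum_mul]
    refine mul_le_mul_of_nonneg_left (add_le_add (Finset.sum_le_sum fun β _ => ?_) ?_) hQ0
    · rw [integral_mul_const]
      refine (mul_le_mul_of_nonneg_right (hc β t ht x).2 (by positivity)).trans ?_
      rw [mul_assoc]
      refine mul_le_mul_of_nonneg_left (rpow_mul_rpow_le_rpow hr0 hrl hl0 hl1
        (le_max_right _ _) ?_) (hc0 β)
      linarith [le_max_left (ord - (β : ℝ)) 0]
    · rw [mul_assoc (A.card * 4 ^ A.card : ℝ)]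
      refine mul_le_mul_of_nonneg_left ?_ (by positivity)
      refine (mul_le_mul_of_nonneg_right (hD t ht x).2 (by positivity)).trans ?_
      rw [mul_assoc]
      refine mul_le_mul_of_nonneg_left (rpow_mul_rpow_le_rpow hr0 hrl hl0 hl1 hP0 ?_) hD0
      linarith [le_max_right ((2 * A.card : ℕ) : ℝ) (ord - A.min' hA)]

theorem exists_forall_abs_sub_le_of_geometric {u : ℕ → ℝ} {B q : ℝ} (hq : q < 1) {n₀ : ℕ}
    (hu : ∀ n, n₀ ≤ n → |u n - u (n + 1)| ≤ B * q ^ n) :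
    ∃ r : ℝ, ∀ n, n₀ ≤ n → |u n - r| ≤ B * q ^ n / (1 - q) := by
  have hstep : ∀ n, n₀ ≤ n → ∀ k, dist (u (n + k)) (u (n + (k + 1))) ≤ B * q ^ n * q ^ k :=
    fun n hn k => by
      rw [Real.dist_eq, mul_assoc, ← pow_add]
      exact hu (n + k) (hn.trans (Nat.le_add_right n k))
  obtain ⟨r, hr⟩ := cauchySeq_tendsto_of_complete
    (cauchySeq_of_le_geometric q (B * q ^ n₀) hq (hstep n₀ le_rfl))
  refine ⟨r, fun n hn => ?_⟩
  have hr' : Filter.Tendsto u Filter.atTop (nhds r) := by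
    rw [← Filter.tendsto_add_atTop_iff_nat n₀]
    simpa only [add_comm n₀] using hr
  have hr'' : Filter.Tendsto (fun k => u (n + k)) Filter.atTop (nhds r) := by
    simpa only [add_comm n] using (Filter.tendsto_add_atTop_iff_nat n).2 hr'
  exact dist_le_of_le_geometric_of_tendsto₀ q (B * q ^ n) hq (hstep n hn) hr''

theorem rpow_rpow_half_pow (a : ℝ) (n : ℕ) :
    (((1 / 2 : ℝ) ^ n) ^ (4⁻¹ : ℝ)) ^ a = (((1 / 2 : ℝ) ^ (4⁻¹ : ℝ)) ^ a) ^ n := by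
  rw [← Real.rpow_mul (by positivity), ← Real.rpow_mul (by positivity), ← Real.rpow_natCast,
    ← Real.rpow_natCast, ← Real.rpow_mul (by positivity), ← Real.rpow_mul (by positivity),
    mul_comm]

theorem half_rpow_rpow_lt_one {a : ℝ} (ha : 0 < a) : ((1 / 2 : ℝ) ^ (4⁻¹ : ℝ)) ^ a < 1 :=
  Real.rpow_lt_one (by positivity)
    (Real.rpow_lt_one (by norm_num) (by norm_num) (by norm_num)) ha

/-- A family of bounded continuous functions which almost satisfies the semigroup property is
close to a tempered distribution. -/
theorem exists_mollDistrib_abs_sub_le {a : ℝ} (ha : 0 < a) :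
    ∃ C : ℝ, 0 ≤ C ∧ ∀ (F : ℝ → ℝ × ℝ → ℝ) (E : ℝ), 0 ≤ E →
      (∀ T, 0 < T → T ≤ 1 → BddContinuous (F T)) →
      (∀ T t : ℝ, 0 < t → t ≤ T → T ≤ 1 → ∀ x,
        |mollify t (F T) x - F (T + t) x| ≤ E * (T ^ (4⁻¹ : ℝ)) ^ a) →
      ∃ R : MollDistrib ℝ, ∀ T, 0 < T → T ≤ 1 → ∀ x,
        |R.app T x - F T x| ≤ C * E * (T ^ (4⁻¹ : ℝ)) ^ a := by
  obtain ⟨K, hK0, hK⟩ := exists_mollify_bound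
  set q : ℝ := ((1 / 2 : ℝ) ^ (4⁻¹ : ℝ)) ^ a with hq
  have hq0 : 0 ≤ q := by positivity
  have hq1 : q < 1 := half_rpow_rpow_lt_one ha
  refine ⟨K / (1 - q) + 1, by have := sub_pos.2 hq1; positivity, fun F E hE hF hFE => ?_⟩
  set G : ℕ → ℝ → ℝ × ℝ → ℝ := fun n T => mollify (T - (1 / 2 : ℝ) ^ n) (F ((1 / 2 : ℝ) ^ n))
    with hG
  have hτ : ∀ n : ℕ, 0 < (1 / 2 : ℝ) ^ n := fun n => by positivity
  have hτ1 : ∀ n : ℕ, (1 / 2 : ℝ) ^ n ≤ 1 := fun n => pow_le_one₀ (by norm_num) (by norm_num)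
  have hFn : ∀ n : ℕ, BddContinuous (F ((1 / 2 : ℝ) ^ n)) := fun n => hF _ (hτ n) (hτ1 n)
  have hstep : ∀ (n : ℕ) (T : ℝ), (1 / 2 : ℝ) ^ n < T → ∀ x,
      |G n T x - G (n + 1) T x| ≤ K * (E * q) * q ^ n := by
    intro n T hT x
    have hsplit : G (n + 1) T = mollify (T - (1 / 2 : ℝ) ^ n)
        (mollify ((1 / 2 : ℝ) ^ (n + 1)) (F ((1 / 2 : ℝ) ^ (n + 1)))) := by
      rw [(hFn (n + 1)).mollify_mollify (hτ _) (sub_pos.2 hT)]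
      simp only [hG]
      congr 1
      ring
    rw [hsplit, ← (hFn n).mollify_sub ((hFn (n + 1)).mollify (hτ _)) (sub_pos.2 hT)]
    refine (hK _ (sub_pos.2 hT) _ (E * q ^ (n + 1)) (fun y => ?_) x).trans (le_of_eq (by ring))
    have h := hFE _ _ (hτ (n + 1)) le_rfl (hτ1 (n + 1)) y
    rw [abs_sub_comm, hq, ← rpow_rpow_half_pow]
    convert h using 4
    ring_nf
  set ε : ℕ → ℝ := fun n => K * (E * q) * q ^ n / (1 - q) with hε
  have hε0 : Filter.Tendsto ε Filter.atTop (nhds 0) := by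
    simpa using ((tendsto_pow_atTop_nhds_zero_of_lt_one hq0 hq1).const_mul
      (K * (E * q))).div_const (1 - q)
  have hlim : ∀ T x, ∃ r : ℝ, ∀ n : ℕ, (1 / 2 : ℝ) ^ n < T → |G n T x - r| ≤ ε n := by
    intro T x
    by_cases hT : ∃ n : ℕ, (1 / 2 : ℝ) ^ n < T
    · obtain ⟨r, hr⟩ := exists_forall_abs_sub_le_of_geometric (u := fun n => G n T x) hq1
        (n₀ := Nat.find hT) fun n hn => hstep n T ((pow_le_pow_of_le_one (by norm_num)
          (by norm_num) hn).trans_lt (Nat.find_spec hT)) x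
      exact ⟨r, fun n hn => hr n (Nat.find_min' hT hn)⟩
    · exact ⟨0, fun n hn => (hT ⟨n, hn⟩).elim⟩
  choose R hR using hlim
  have hsmall : ∀ T : ℝ, 0 < T → ∀ᶠ n : ℕ in Filter.atTop, (1 / 2 : ℝ) ^ n < T := fun T hT =>
    (tendsto_pow_atTop_nhds_zero_of_lt_one (by norm_num) (by norm_num)).eventually_lt_const hT
  have hGb : ∀ (n : ℕ) (T : ℝ), (1 / 2 : ℝ) ^ n < T → BddContinuous (G n T) := fun n T hT =>
    (hFn n).mollify (sub_pos.2 hT)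
  have hRb : ∀ T, 0 < T → BddContinuous (R T) := by
    intro T hT
    constructor
    · refine TendstoUniformly.continuous (F := fun n => G n T) (p := Filter.atTop) ?_
        ((hsmall T hT).mono fun n hn => (hGb n T hn).1).frequently
      rw [Metric.tendstoUniformly_iff]
      intro δ hδ
      filter_upwards [hsmall T hT, hε0.eventually_lt_const hδ] with n hn hnδ x
      rw [dist_comm]
      exact (hR T x n hn).trans_lt hnδ
    · obtain ⟨n, hn⟩ := (hsmall T hT).exists
      obtain ⟨-, B, hB⟩ := hGb n T hn
      refine ⟨B + ε n, fun x => ?_⟩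
      have h1 := abs_le.1 (hB x)
      have h2 := abs_le.1 (hR T x n hn)
      exact abs_le.2 ⟨by linarith [h1.1, h2.2], by linarith [h1.2, h2.1]⟩
  refine ⟨⟨R, fun T hT => (hRb T hT).1, fun T hT t ht => funext fun x => ?_⟩,
    fun T hT hT1 x => ?_⟩
  · have hle : |R (T + t) x - mollify t (R T) x| ≤ 0 := by
      have h0 : Filter.Tendsto (fun n => ε n + K * ε n) Filter.atTop (nhds 0) := by
        simpa using hε0.add (hε0.const_mul K)
      refine ge_of_tendsto h0 ((hsmall T hT).mono fun n hn => ?_)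
      have hGt : G n (T + t) = mollify t (G n T) := by
        simp only [hG]
        rw [(hFn n).mollify_mollify (sub_pos.2 hn) ht]
        congr 1
        ring
      have h1 := hR (T + t) x n (by linarith)
      have h2 := hK t ht _ (ε n) (fun y => hR T y n hn) x
      rw [(hGb n T hn).mollify_sub (hRb T hT) ht] at h2
      rw [hGt, abs_sub_comm] at h1
      exact (abs_sub_le _ _ _).trans (add_le_add h1 h2)
    exact sub_eq_zero.1 (abs_nonpos_iff.1 hle)
  · obtain ⟨n, hn1, hn2⟩ := exists_nat_pow_near_of_lt_one hT hT1
      (by norm_num : (0 : ℝ) < 1 / 2) (by norm_num)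
    have h1 := hR T x (n + 1) hn1
    have h2 := hFE ((1 / 2 : ℝ) ^ (n + 1)) (T - (1 / 2 : ℝ) ^ (n + 1)) (sub_pos.2 hn1)
      (by rw [pow_succ]; linarith) (hτ1 _) x
    rw [add_sub_cancel] at h2
    rw [abs_sub_comm] at h1
    have hqT : q ^ (n + 1) ≤ (T ^ (4⁻¹ : ℝ)) ^ a := by
      rw [hq, ← rpow_rpow_half_pow]
      exact Real.rpow_le_rpow (by positivity)
        (Real.rpow_le_rpow (by positivity) hn1.le (by norm_num)) ha.le
    rw [rpow_rpow_half_pow, ← hq] at h2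
    have hq' := sub_pos.2 hq1
    calc |R T x - F T x| ≤ ε (n + 1) + E * q ^ (n + 1) :=
          (abs_sub_le _ _ _).trans (add_le_add h1 h2)
      _ = K / (1 - q) * E * q ^ (n + 1) * q + E * q ^ (n + 1) := by simp only [hε]; ring
      _ ≤ K / (1 - q) * E * q ^ (n + 1) * 1 + E * q ^ (n + 1) := by gcongr
      _ = (K / (1 - q) + 1) * E * q ^ (n + 1) := by ring
      _ ≤ _ := by gcongr

theorem MollDistrib.app_eq_of_abs_sub_le {a D : ℝ} (ha : 0 < a) {F : ℝ → ℝ × ℝ → ℝ}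
    (hF : ∀ T, 0 < T → T ≤ 1 → BddContinuous (F T)) {R R' : MollDistrib ℝ}
    (hR : ∀ T, 0 < T → T ≤ 1 → ∀ x, |R.app T x - F T x| ≤ D * (T ^ (4⁻¹ : ℝ)) ^ a)
    (hR' : ∀ T, 0 < T → T ≤ 1 → ∀ x, |R'.app T x - F T x| ≤ D * (T ^ (4⁻¹ : ℝ)) ^ a)
    {T : ℝ} (hT : 0 < T) : R'.app T = R.app T := by
  have hbdd : ∀ R : MollDistrib ℝ,
      (∀ T, 0 < T → T ≤ 1 → ∀ x, |R.app T x - F T x| ≤ D * (T ^ (4⁻¹ : ℝ)) ^ a) →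
      ∀ T, 0 < T → T ≤ 1 → BddContinuous (R.app T) := by
    intro R hR T hT hT1
    obtain ⟨-, B, hB⟩ := hF T hT hT1
    refine ⟨R.cont T hT, D * (T ^ (4⁻¹ : ℝ)) ^ a + B, fun x => ?_⟩
    simpa using (abs_add_le (R.app T x - F T x) (F T x)).trans
      (add_le_add (hR T hT hT1 x) (hB x))
  obtain ⟨K, -, hK⟩ := exists_mollify_bound
  funext x
  have hle : |R'.app T x - R.app T x| ≤ 0 := by
    have h0 : Filter.Tendsto (fun n : ℕ => K * (2 * D * (((1 / 2 : ℝ) ^ (4⁻¹ : ℝ)) ^ a) ^ n))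
        Filter.atTop (nhds 0) := by
      simpa using ((tendsto_pow_atTop_nhds_zero_of_lt_one (by positivity)
        (half_rpow_rpow_lt_one ha)).const_mul (2 * D)).const_mul K
    have hsmall : ∀ᶠ n : ℕ in Filter.atTop, (1 / 2 : ℝ) ^ n < T :=
      (tendsto_pow_atTop_nhds_zero_of_lt_one (by norm_num) (by norm_num)).eventually_lt_const hT
    refine ge_of_tendsto h0 (hsmall.mono fun n hn => ?_)
    have hτ : 0 < (1 / 2 : ℝ) ^ n := by positivity
    have hτ1 : (1 / 2 : ℝ) ^ n ≤ 1 := pow_le_one₀ (by norm_num) (by norm_num)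
    have hsplit : ∀ R : MollDistrib ℝ, R.app T =
        mollify (T - (1 / 2 : ℝ) ^ n) (R.app ((1 / 2 : ℝ) ^ n)) := fun R => by
      rw [← R.semigroup _ hτ _ (sub_pos.2 hn), add_sub_cancel]
    rw [hsplit R, hsplit R', ← (hbdd R' hR' _ hτ hτ1).mollify_sub (hbdd R hR _ hτ hτ1)
      (sub_pos.2 hn)]
    refine hK _ (sub_pos.2 hn) _ _ (fun y => ?_) x
    have h1 := hR _ hτ hτ1 y
    have h2 := hR' _ hτ hτ1 y
    rw [abs_sub_comm] at h1
    rw [← rpow_rpow_half_pow, mul_assoc, two_mul]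
    exact (abs_sub_le _ _ _).trans (add_le_add h2 h1)
  exact sub_eq_zero.1 (abs_nonpos_iff.1 hle)

/-- **Reconstruction.** -/
theorem reconstruction (A : Finset ℝ) (hA : A.Nonempty)
    (hmin₁ : (-4 : ℝ) < A.min' hA) (hmin₂ : A.min' hA < 0)
    (ord : ℝ) (hord : 0 < ord) :
    ∃ C : ℝ, 0 < C ∧
      ∀ (Tb : A → Type*) [∀ β, NormedAddCommGroup (Tb β)] [∀ β, NormedSpace ℝ (Tb β)]
        (S : PreSkeleton A Tb), S.IsSkeleton →
        ∀ v : MollDistrib (∀ γ : A, Tb γ),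
          (∀ (β : A) (x : ℝ × ℝ) (T : ℝ), 0 < T → T ≤ 1 →
            ‖S.apply x β (v.app T x)‖ ≤ (T ^ (4⁻¹ : ℝ)) ^ (β : ℝ)) →
        ∀ V : ℝ × ℝ → (∀ γ : A, Tb γ) → ℝ, S.IsModelled ord V →
          ∃ RV : MollDistrib ℝ,
            (∀ T : ℝ, 0 < T → T ≤ 1 → ∀ x,
              |RV.app T x - V x (v.app T x)| ≤
                C * (1 + S.skelNorm) ^ (A.card - 1) * S.ctyNorm ord V *
                  (T ^ (4⁻¹ : ℝ)) ^ ord) ∧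
            ∀ RV' : MollDistrib ℝ,
              (∀ T : ℝ, 0 < T → T ≤ 1 → ∀ x,
                |RV'.app T x - V x (v.app T x)| ≤
                  C * (1 + S.skelNorm) ^ (A.card - 1) * S.ctyNorm ord V *
                    (T ^ (4⁻¹ : ℝ)) ^ ord) →
              ∀ T : ℝ, 0 < T → RV'.app T = RV.app T := by
  obtain ⟨C₁, hC₁, hcomm⟩ := exists_mollify_sub_le A hA ord
  obtain ⟨C₂, hC₂, hex⟩ := exists_mollDistrib_abs_sub_le hord
  refine ⟨C₂ * C₁ + 1, by positivity, fun Tb _ _ S hS v hv V hV => ?_⟩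
  have hL := S.skelNorm_nonneg
  have hM := S.ctyNorm_nonneg ord V
  have hF : ∀ T, 0 < T → T ≤ 1 → BddContinuous fun x => V x (v.app T x) := fun T hT hT1 =>
    hV.bddContinuous hS (v.cont T hT) fun β x => hv β x T hT hT1
  obtain ⟨R, hR⟩ := hex (fun T x => V x (v.app T x))
    (C₁ * (S.ctyNorm ord V * (1 + S.skelNorm) ^ (A.card - 1))) (by positivity) hF
    (hcomm Tb S hS v hv V hV)
  have hR₁ : ∀ T : ℝ, 0 < T → T ≤ 1 → ∀ x, |R.app T x - V x (v.app T x)| ≤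
      (C₂ * C₁ + 1) * (1 + S.skelNorm) ^ (A.card - 1) * S.ctyNorm ord V *
        (T ^ (4⁻¹ : ℝ)) ^ ord := fun T hT hT1 x => by
    refine (hR T hT hT1 x).trans (mul_le_mul_of_nonneg_right ?_ (by positivity))
    have : 0 ≤ (1 + S.skelNorm) ^ (A.card - 1) * S.ctyNorm ord V := by positivity
    linarith
  exact ⟨R, hR₁, fun R' hR' T hT => MollDistrib.app_eq_of_abs_sub_le hord hF hR₁ hR' hT⟩
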